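/- arXiv:2004.01877 — 12 statements merged into one kernel-verified Lean document; each statement's English description precedes it below -/
import Mathlib

section
/- For every real 3×3 matrix T with tr T = 0, setting b = tr T², c = tr T³ and H = −3T² + 2b·I, one has the identity H · (3b·T² + 6c·T + (b²/2)·I) = (b³ − 6c²)·I. -/
open Matrix

/-- The Cayley–Hamilton relation of a traceless 3×3 matrix, written with power traces. -/
theorem pow_three_eq_of_trace_eq_zero (T : Matrix (Fin 3) (Fin 3) ℝ) (hT : T.trace = 0) :
    T ^ 3 = ((T ^ 2).trace / 2) • T +
      ((T ^ 3).trace / 3) • (1 : Matrix (Fin 3) (Fin 3) ℝ) := by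
  have h : T 2 2 = -T 0 0 - T 1 1 := by
    rw [Matrix.trace_fin_three] at hT
    linarith
  ext i j
  fin_cases i <;> fin_cases j <;>
    simp [pow_succ, Matrix.mul_apply, Matrix.trace_fin_three, Fin.sum_univ_three, h] <;> ring

/-- For every real 3×3 matrix `T` with `tr T = 0`, setting `b = tr T²`, `c = tr T³` and
`H = −3T² + 2b·I`, one has `H · (3b·T² + 6c·T + (b²/2)·I) = (b³ − 6c²)·I`. -/
theorem H_inverse_identity (T : Matrix (Fin 3) (Fin 3) ℝ) (hT : T.trace = 0) :
    ((-3 : ℝ) • T ^ 2 + (2 * (T ^ 2).trace) • (1 : Matrix (Fin 3) (Fin 3) ℝ)) *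
      ((3 * (T ^ 2).trace) • T ^ 2 + (6 * (T ^ 3).trace) • T +
        ((T ^ 2).trace ^ 2 / 2) • (1 : Matrix (Fin 3) (Fin 3) ℝ)) =
      ((T ^ 2).trace ^ 3 - 6 * (T ^ 3).trace ^ 2) • (1 : Matrix (Fin 3) (Fin 3) ℝ) := by
  have h3 := pow_three_eq_of_trace_eq_zero T hT
  generalize (T ^ 2).trace = b at *
  generalize (T ^ 3).trace = c at *
  have h21 : T ^ 2 * T = (b / 2) • T + (c / 3) • 1 := by rw [← pow_succ, h3]
  have h22 : T ^ 2 * T ^ 2 = (b / 2) • T ^ 2 + (c / 3) • T := by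
    rw [pow_two T, ← mul_assoc, ← pow_two, h21, add_mul, smul_mul_assoc, smul_mul_assoc,
      one_mul, ← pow_two]
  simp only [add_mul, mul_add, smul_mul_assoc, mul_smul_comm, one_mul, mul_one, h21, h22]
  module
end

section
/- Let T be a real symmetric 3×3 matrix with tr T = 0, let e₀, e₁, e₂ be the standard basis of ℝ³, and for each pair of indices k, l define the vector v_{kl} = e_k × (T e_l) + e_l × (T e_k), where × is the cross product on ℝ³. Then Σ_{k,l} v_{kl} (v_{kl})ᵀ = 2(−3T² + 2b·I), where b = tr T². -/
open Matrix

/-- For a real symmetric traceless 3×3 matrix `T`, with `v_{kl} = e_k × (T e_l) + e_l × (T e_k)`,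
one has `Σ_{k,l} v_{kl} v_{kl}ᵀ = 2(−3T² + 2b·I)` where `b = tr T²`. -/
theorem sum_B_squared (T : Matrix (Fin 3) (Fin 3) ℝ) (hsymm : Tᵀ = T)
    (hT : T.trace = 0) :
    (∑ k : Fin 3, ∑ l : Fin 3,
        Matrix.vecMulVec
          (crossProduct (Pi.single k (1 : ℝ)) (T *ᵥ Pi.single l (1 : ℝ)) +
            crossProduct (Pi.single l (1 : ℝ)) (T *ᵥ Pi.single k (1 : ℝ)))
          (crossProduct (Pi.single k (1 : ℝ)) (T *ᵥ Pi.single l (1 : ℝ)) +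
            crossProduct (Pi.single l (1 : ℝ)) (T *ᵥ Pi.single k (1 : ℝ)))) =
      (2 : ℝ) • ((-3 : ℝ) • T ^ 2 + (2 * (T ^ 2).trace) • (1 : Matrix (Fin 3) (Fin 3) ℝ)) := by
  have h10 : T 1 0 = T 0 1 := congrFun₂ hsymm 0 1
  have h20 : T 2 0 = T 0 2 := congrFun₂ hsymm 0 2
  have h21 : T 2 1 = T 1 2 := congrFun₂ hsymm 1 2
  have h22 : T 2 2 = -T 0 0 - T 1 1 := by
    rw [Matrix.trace_fin_three] at hT
    linarith
  ext i j
  fin_cases i <;> fin_cases j <;>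
    simp [Fin.sum_univ_three, cross_apply, pow_two, Matrix.mul_apply,
      Matrix.trace_fin_three, h10, h20, h21, h22] <;>
    ring
end

section
/- Every real symmetric 3×3 matrix S with tr S = 0 satisfies (tr S²)³ ≥ 6 (tr S³)², with equality if and only if S has a repeated eigenvalue (i.e., S has fewer than three distinct eigenvalues). -/
open Matrix

/-- The trace of a power of a Hermitian matrix is the corresponding power sum of its eigenvalues. -/
theorem Matrix.IsHermitian.trace_pow_eq_sum_eigenvalues_pow {𝕜 n : Type*} [RCLike 𝕜] [Fintype n]
    [DecidableEq n] {A : Matrix n n 𝕜} (hA : A.IsHermitian) (k : ℕ) :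
    (A ^ k).trace = ∑ i, (hA.eigenvalues i : 𝕜) ^ k := by
  conv_lhs => rw [hA.spectral_theorem, ← map_pow, Unitary.conjStarAlgAut_apply, trace_mul_comm,
    ← mul_assoc]
  simp [diagonal_pow, trace_diagonal]

/-- The discriminant of three numbers with sum zero, in terms of their power sums. -/
theorem sum_sq_pow_three_sub_of_add_eq_zero {R : Type*} [CommRing R] {a b c : R}
    (h : a + b + c = 0) :
    (a ^ 2 + b ^ 2 + c ^ 2) ^ 3 - 6 * (a ^ 3 + b ^ 3 + c ^ 3) ^ 2 =
      2 * ((a - b) * (b - c) * (c - a)) ^ 2 := by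
  obtain rfl : c = -a - b := by linear_combination h
  ring

theorem not_injective_fin_three_iff {α : Type*} (f : Fin 3 → α) :
    ¬ Function.Injective f ↔ f 0 = f 1 ∨ f 1 = f 2 ∨ f 2 = f 0 := by
  simp only [Function.Injective, Fin.forall_fin_succ]
  simp
  grind

/-- Every real symmetric 3×3 matrix `S` with `tr S = 0` satisfies `(tr S²)³ ≥ 6 (tr S³)²`,
with equality if and only if `S` has a repeated eigenvalue. -/
theorem traceless_symmetric_inequality (S : Matrix (Fin 3) (Fin 3) ℝ)
    (hS : S.IsHermitian) (h0 : S.trace = 0) :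
    (S ^ 2).trace ^ 3 ≥ 6 * (S ^ 3).trace ^ 2 ∧
      ((S ^ 2).trace ^ 3 = 6 * (S ^ 3).trace ^ 2 ↔
        ¬ Function.Injective hS.eigenvalues) := by
  have hsum : hS.eigenvalues 0 + hS.eigenvalues 1 + hS.eigenvalues 2 = 0 := by
    simpa [Fin.sum_univ_three, h0] using hS.trace_eq_sum_eigenvalues.symm
  have key := sum_sq_pow_three_sub_of_add_eq_zero hsum
  simp only [hS.trace_pow_eq_sum_eigenvalues_pow, Fin.sum_univ_three, RCLike.ofReal_real_eq_id,
    id_eq]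
  refine ⟨sub_nonneg.mp (key ▸ by positivity), ?_⟩
  rw [← sub_eq_zero, key, not_injective_fin_three_iff]
  simp [sub_eq_zero, or_assoc]
end

section
/- Let R be a real symmetric 3×3 matrix and set r = tr R, S = R − (r/3)·I, s = tr S², t = tr S³. Then R has exactly two distinct eigenvalues if and only if 6t² = s³ and s ≠ 0. -/
/-- The trace of a power of a shifted Hermitian matrix, in terms of the eigenvalues. -/
theorem Matrix.IsHermitian.trace_sub_smul_one_pow {𝕜 n : Type*} [RCLike 𝕜] [Fintype n]
    [DecidableEq n] {A : Matrix n n 𝕜} (hA : A.IsHermitian) (c : 𝕜) (k : ℕ) :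
    ((A - c • (1 : Matrix n n 𝕜)) ^ k).trace = ∑ i, ((hA.eigenvalues i : 𝕜) - c) ^ k := by
  have h : A - c • (1 : Matrix n n 𝕜) =
      Unitary.conjStarAlgAut 𝕜 _ hA.eigenvectorUnitary
        (diagonal fun i => (hA.eigenvalues i : 𝕜) - c) := by
    conv_lhs => rw [hA.spectral_theorem]
    rw [← map_one (Unitary.conjStarAlgAut 𝕜 _ hA.eigenvectorUnitary), ← map_smul, ← map_sub,
      smul_one_eq_diagonal, diagonal_sub]
    rfl
  rw [h, ← map_pow, Unitary.conjStarAlgAut_apply, trace_mul_comm, ← mul_assoc,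
    Unitary.coe_star_mul_self, one_mul, diagonal_pow, trace_diagonal]
  rfl

/-- A triple takes exactly two values iff two of its entries agree but not all three. -/
theorem Fin.card_image_univ_three_eq_two_iff {α : Type*} [DecidableEq α] (f : Fin 3 → α) :
    (Finset.univ.image f).card = 2 ↔
      (f 0 = f 1 ∨ f 1 = f 2 ∨ f 2 = f 0) ∧ ¬(f 0 = f 1 ∧ f 1 = f 2) := by
  have h : Finset.univ.image f = {f 0, f 1, f 2} := by
    ext x
    simp [Fin.exists_fin_succ, eq_comm]
  rw [h]
  by_cases h01 : f 0 = f 1 <;> by_cases h12 : f 1 = f 2 <;> by_cases h20 : f 2 = f 0 <;>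
    grind

/-- A real symmetric 3×3 matrix `R` has exactly two distinct eigenvalues if and only if
`6t² = s³` and `s ≠ 0`, where `S = R − (tr R/3)·I`, `s = tr S²`, `t = tr S³`. -/
theorem two_distinct_eigenvalues_iff (R : Matrix (Fin 3) (Fin 3) ℝ)
    (hR : R.IsHermitian) :
    (Finset.univ.image hR.eigenvalues).card = 2 ↔
      6 * (((R - (R.trace / 3) • (1 : Matrix (Fin 3) (Fin 3) ℝ)) ^ 3).trace) ^ 2 =
          (((R - (R.trace / 3) • (1 : Matrix (Fin 3) (Fin 3) ℝ)) ^ 2).trace) ^ 3 ∧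
        ((R - (R.trace / 3) • (1 : Matrix (Fin 3) (Fin 3) ℝ)) ^ 2).trace ≠ 0 := by
  rw [Fin.card_image_univ_three_eq_two_iff, hR.trace_sub_smul_one_pow,
    hR.trace_sub_smul_one_pow, hR.trace_eq_sum_eigenvalues]
  simp only [Fin.sum_univ_three, RCLike.ofReal_real_eq_id, id_eq]
  generalize hR.eigenvalues 0 = x
  generalize hR.eigenvalues 1 = y
  generalize hR.eigenvalues 2 = z
  set s := (x - (x + y + z) / 3) ^ 2 + (y - (x + y + z) / 3) ^ 2 + (z - (x + y + z) / 3) ^ 2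
    with hs
  set t := (x - (x + y + z) / 3) ^ 3 + (y - (x + y + z) / 3) ^ 3 + (z - (x + y + z) / 3) ^ 3
    with ht
  have discr : s ^ 3 - 6 * t ^ 2 = 2 * ((x - y) * (y - z) * (z - x)) ^ 2 := by
    rw [hs, ht]; ring
  have spread : 3 * s = (x - y) ^ 2 + (y - z) ^ 2 + (z - x) ^ 2 := by
    rw [hs]; ring
  refine and_congr ?_ (not_congr ?_)
  · calc (x = y ∨ y = z ∨ z = x) ↔ (x - y) * (y - z) * (z - x) = 0 := by
          simp only [mul_eq_zero, sub_eq_zero, or_assoc]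
      _ ↔ 2 * ((x - y) * (y - z) * (z - x)) ^ 2 = 0 := by simp
      _ ↔ 6 * t ^ 2 = s ^ 3 := by rw [← discr, sub_eq_zero, eq_comm]
  · constructor
    · rintro ⟨rfl, rfl⟩
      rw [hs]; ring
    · intro h
      constructor <;> nlinarith [sq_nonneg (x - y), sq_nonneg (y - z), sq_nonneg (z - x)]
end

section
/- Let u ∈ ℝ³ be a unit vector, let α ≠ β be real numbers, and let R = (α − β)·u uᵀ + β·I. With r = tr R, S = R − (r/3)·I, s = tr S² and t = tr S³, one has t ≠ 0 and (1/t)·(2S³ − (4/3)·s·S) = I − u uᵀ, i.e. this matrix is the orthogonal projection onto the plane orthogonal to u. -/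
open Matrix

/-- For `R = (α − β)·u uᵀ + β·I` with `u` a unit vector and `α ≠ β`, setting `r = tr R`,
`S = R − (r/3)·I`, `s = tr S²`, `t = tr S³`, one has `t ≠ 0` and
`(1/t)·(2S³ − (4/3)s·S) = I − u uᵀ`. -/
theorem projector_from_Ricci (u : Fin 3 → ℝ) (hu : u ⬝ᵥ u = 1)
    (α β : ℝ) (hαβ : α ≠ β) (R : Matrix (Fin 3) (Fin 3) ℝ)
    (hR : R = (α - β) • Matrix.vecMulVec u u + β • (1 : Matrix (Fin 3) (Fin 3) ℝ)) :
    (((R - (R.trace / 3) • (1 : Matrix (Fin 3) (Fin 3) ℝ)) ^ 3).trace ≠ 0) ∧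
      (1 / ((R - (R.trace / 3) • (1 : Matrix (Fin 3) (Fin 3) ℝ)) ^ 3).trace) •
          ((2 : ℝ) • (R - (R.trace / 3) • (1 : Matrix (Fin 3) (Fin 3) ℝ)) ^ 3 -
            (4 / 3 * ((R - (R.trace / 3) • (1 : Matrix (Fin 3) (Fin 3) ℝ)) ^ 2).trace) •
              (R - (R.trace / 3) • (1 : Matrix (Fin 3) (Fin 3) ℝ))) =
        (1 : Matrix (Fin 3) (Fin 3) ℝ) - Matrix.vecMulVec u u := by
  set P := Matrix.vecMulVec u u with hP
  have hPP : P * P = P := by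
    rw [hP, Matrix.vecMulVec_mul_vecMulVec, hu, one_smul]
  have hPtr : P.trace = 1 := by rw [hP, Matrix.trace_vecMulVec, hu]
  have hd : α - β ≠ 0 := sub_ne_zero.mpr hαβ
  have hS : R - (R.trace / 3) • (1 : Matrix (Fin 3) (Fin 3) ℝ) =
      (α - β) • (P - (1 / 3 : ℝ) • 1) := by
    simp only [hR, Matrix.trace_add, Matrix.trace_smul, hPtr, Matrix.trace_one,
      Fintype.card_fin, smul_eq_mul]
    module
  have hS2 : ((α - β) • (P - (1 / 3 : ℝ) • 1)) ^ 2 =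
      (α - β) ^ 2 • ((1 / 3 : ℝ) • P + (1 / 9 : ℝ) • 1) := by
    rw [smul_pow, sq (P - _)]
    simp only [sub_mul, mul_sub, hPP, smul_mul_assoc, mul_smul_comm, one_mul, mul_one]
    module
  have hS3 : ((α - β) • (P - (1 / 3 : ℝ) • 1)) ^ 3 =
      (α - β) ^ 3 • ((1 / 3 : ℝ) • P - (1 / 27 : ℝ) • 1) := by
    rw [pow_succ, hS2]
    simp only [add_mul, mul_sub, hPP, smul_mul_assoc, mul_smul_comm, one_mul, mul_one]
    module
  have hs : ((α - β) ^ 2 • ((1 / 3 : ℝ) • P + (1 / 9 : ℝ) • 1)).trace =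
      2 / 3 * (α - β) ^ 2 := by
    simp only [Matrix.trace_add, Matrix.trace_smul, hPtr, Matrix.trace_one,
      Fintype.card_fin, smul_eq_mul]
    push_cast
    ring
  have ht : ((α - β) ^ 3 • ((1 / 3 : ℝ) • P - (1 / 27 : ℝ) • 1)).trace =
      2 / 9 * (α - β) ^ 3 := by
    simp only [Matrix.trace_sub, Matrix.trace_smul, hPtr, Matrix.trace_one,
      Fintype.card_fin, smul_eq_mul]
    push_cast
    ring
  have ht0 : 2 / 9 * (α - β) ^ 3 ≠ 0 := by positivity
  rw [hS, hS2, hS3, hs, ht]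
  refine ⟨ht0, ?_⟩
  rw [one_div, inv_smul_eq_iff₀ ht0]
  module
end

section
/- Let u ∈ ℝ³ be a unit vector, let α ≠ β be real numbers, and let R = (α − β)·u uᵀ + β·I. With r = tr R, S = R − (r/3)·I and t = tr S³, the scalar 16r³ + 9t has the same sign as α + β: it is zero iff α + β = 0, positive iff α + β > 0, and negative iff α + β < 0. -/
open Matrix

/-- The rank-one projection onto a unit vector has deviator with cubic invariant `2 / 9`. -/
lemma trace_vecMulVec_self_sub_third_pow_three (u : Fin 3 → ℝ) (hu : u ⬝ᵥ u = 1) :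
    ((vecMulVec u u - (1 / 3 : ℝ) • (1 : Matrix (Fin 3) (Fin 3) ℝ)) ^ 3).trace = 2 / 9 := by
  have hP : vecMulVec u u * vecMulVec u u = vecMulVec u u := by
    rw [vecMulVec_mul_vecMulVec, hu, one_smul]
  have hcube : (vecMulVec u u - (1 / 3 : ℝ) • (1 : Matrix (Fin 3) (Fin 3) ℝ)) ^ 3
      = (1 / 3 : ℝ) • vecMulVec u u - (1 / 27 : ℝ) • (1 : Matrix (Fin 3) (Fin 3) ℝ) := by
    simp only [pow_succ, pow_zero, one_mul, sub_mul, mul_sub, smul_mul_assoc, mul_smul_comm,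
      mul_one, hP]
    module
  rw [hcube, trace_sub, trace_smul, trace_smul, trace_vecMulVec, hu, trace_one]
  norm_num

/-- For `R = (α − β)·u uᵀ + β·I` with `u` a unit vector and `α ≠ β`, setting `r = tr R`,
`S = R − (r/3)·I`, `t = tr S³`, the scalar `16r³ + 9t` has the same sign as `α + β`. -/
theorem sign_of_16r3_plus_9t (u : Fin 3 → ℝ) (hu : u ⬝ᵥ u = 1)
    (α β : ℝ) (hαβ : α ≠ β) (R : Matrix (Fin 3) (Fin 3) ℝ)
    (hR : R = (α - β) • Matrix.vecMulVec u u + β • (1 : Matrix (Fin 3) (Fin 3) ℝ)) :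
    (16 * R.trace ^ 3 +
          9 * ((R - (R.trace / 3) • (1 : Matrix (Fin 3) (Fin 3) ℝ)) ^ 3).trace = 0 ↔
        α + β = 0) ∧
      (0 < 16 * R.trace ^ 3 +
          9 * ((R - (R.trace / 3) • (1 : Matrix (Fin 3) (Fin 3) ℝ)) ^ 3).trace ↔
        0 < α + β) ∧
      (16 * R.trace ^ 3 +
          9 * ((R - (R.trace / 3) • (1 : Matrix (Fin 3) (Fin 3) ℝ)) ^ 3).trace < 0 ↔
        α + β < 0) := by
  have htr : R.trace = α + 2 * β := by
    rw [hR, trace_add, trace_smul, trace_smul, trace_vecMulVec, hu, trace_one]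
    simp only [Fintype.card_fin, smul_eq_mul, Nat.cast_ofNat]
    ring
  have hS : R - (R.trace / 3) • (1 : Matrix (Fin 3) (Fin 3) ℝ)
      = (α - β) • (vecMulVec u u - (1 / 3 : ℝ) • (1 : Matrix (Fin 3) (Fin 3) ℝ)) := by
    rw [htr, hR]
    module
  have hfactor : 16 * R.trace ^ 3 +
      9 * ((R - (R.trace / 3) • (1 : Matrix (Fin 3) (Fin 3) ℝ)) ^ 3).trace
      = (α + β) *
        (6 * (2 * (α + 2 * β) - (α - β) / 2) ^ 2 + 9 / 2 * (α - β) ^ 2) := by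
    rw [hS, smul_pow, trace_smul, trace_vecMulVec_self_sub_third_pow_three u hu, htr, smul_eq_mul]
    ring
  have hpos : 0 < 6 * (2 * (α + 2 * β) - (α - β) / 2) ^ 2 + 9 / 2 * (α - β) ^ 2 := by
    have : α - β ≠ 0 := sub_ne_zero.mpr hαβ
    positivity
  rw [hfactor]
  exact ⟨mul_eq_zero_iff_right hpos.ne', mul_pos_iff_of_pos_right hpos,
    by simp [mul_neg_iff, hpos, hpos.not_gt]⟩
end

section
/- Let (u, v, w) be an orthonormal basis of ℝ³, let φ, ψ, A be real numbers with A ≥ 0, and let R = (φ − ψ)·[φ·v vᵀ − ψ·w wᵀ − A·(v wᵀ + w vᵀ)] − (1/2)·[(φ − ψ)² + 4A²]·I. Then u is an eigenvector of R with eigenvalue α₁ = −(1/2)[(φ − ψ)² + 4A²], and the remaining two eigenvalues of R are α± = −2A² ± (1/2)(φ − ψ)·√((φ + ψ)² + 4A²). -/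
open Matrix

/-- Two families indexed by `Fin n` with the same multiset of values agree up to a permutation. -/
theorem exists_perm_comp_eq_of_map_univ_eq {n : ℕ} {α : Type*} [LinearOrder α] {f g : Fin n → α}
    (h : Multiset.map f Finset.univ.val = Multiset.map g Finset.univ.val) :
    ∃ σ : Equiv.Perm (Fin n), f ∘ σ = g := by
  have hperm : (List.ofFn f).Perm (List.ofFn g) := by
    simpa [Fin.univ_val_map] using h
  have hsort : f ∘ Tuple.sort f = g ∘ Tuple.sort g := by
    apply List.ofFn_injective
    refine List.Perm.eq_of_sortedLE (Tuple.monotone_sort f).sortedLE_ofFn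
      (Tuple.monotone_sort g).sortedLE_ofFn ?_
    exact ((Equiv.Perm.ofFn_comp_perm _ f).trans hperm).trans
      (Equiv.Perm.ofFn_comp_perm _ g).symm
  refine ⟨(Tuple.sort g).symm.trans (Tuple.sort f), ?_⟩
  ext i
  simpa using congrFun hsort ((Tuple.sort g).symm i)

/-- If the characteristic polynomial of a real symmetric matrix is `∏ i, (X - a i)`, its eigenvalues
are the `a i` up to order. -/
theorem Matrix.IsHermitian.exists_perm_eigenvalues_comp_eq {n : ℕ} {M : Matrix (Fin n) (Fin n) ℝ}
    (hM : M.IsHermitian) {a : Fin n → ℝ}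
    (h : M.charpoly = ∏ i, (Polynomial.X - Polynomial.C (a i))) :
    ∃ σ : Equiv.Perm (Fin n), hM.eigenvalues ∘ σ = a := by
  apply exists_perm_comp_eq_of_map_univ_eq
  have hroots := hM.roots_charpoly_eq_eigenvalues
  rw [h, Finset.prod_eq_multiset_prod,
    ← Function.comp_def (fun x => Polynomial.X - Polynomial.C x) a, ← Multiset.map_map,
    Polynomial.roots_multiset_prod_X_sub_C] at hroots
  exact hroots.symm

/-- Conjugation by a matrix with a left inverse does not change the characteristic polynomial. -/
theorem Matrix.charpoly_conj_of_mul_eq_one {n R : Type*} [Fintype n] [DecidableEq n] [CommRing R]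
    {P Q : Matrix n n R} (h : Q * P = 1) (N : Matrix n n R) :
    (P * N * Q).charpoly = N.charpoly := by
  rw [Matrix.charpoly_mul_comm, ← mul_assoc, h, one_mul]

/-- The characteristic polynomial of the matrix `R` of the theorem in the basis `(u, v, w)`. -/
theorem charpoly_ricci_block (φ ψ A : ℝ) :
    ((φ - ψ) • !![0, 0, 0; 0, φ, -A; 0, -A, -ψ] -
      ((1 / 2) * ((φ - ψ) ^ 2 + 4 * A ^ 2)) • (1 : Matrix (Fin 3) (Fin 3) ℝ)).charpoly =
      ∏ i, (Polynomial.X - Polynomial.C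
        (![-(1 / 2) * ((φ - ψ) ^ 2 + 4 * A ^ 2),
            -2 * A ^ 2 + (1 / 2) * (φ - ψ) * Real.sqrt ((φ + ψ) ^ 2 + 4 * A ^ 2),
            -2 * A ^ 2 - (1 / 2) * (φ - ψ) * Real.sqrt ((φ + ψ) ^ 2 + 4 * A ^ 2)] i)) := by
  have hs : Real.sqrt ((φ + ψ) ^ 2 + 4 * A ^ 2) ^ 2 = (φ + ψ) ^ 2 + 4 * A ^ 2 :=
    Real.sq_sqrt (by positivity)
  apply Polynomial.funext
  intro x
  rw [Matrix.eval_charpoly, Matrix.det_fin_three, Fin.prod_univ_three]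
  simp
  linear_combination (1 / 4 * (φ - ψ) ^ 2 *
    (x + 1 / 2 * ((φ - ψ) ^ 2 + 4 * A ^ 2))) * hs

/-- For an orthonormal basis `(u,v,w)` of ℝ³, `A ≥ 0`, and
`R = (φ − ψ)·[φ·v vᵀ − ψ·w wᵀ − A·(v wᵀ + w vᵀ)] − (1/2)·[(φ − ψ)² + 4A²]·I`,
`u` is an eigenvector of `R` with eigenvalue `α₁ = −(1/2)[(φ−ψ)² + 4A²]` and the
remaining two eigenvalues are `α± = −2A² ± (1/2)(φ−ψ)·√((φ+ψ)² + 4A²)`. -/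
theorem eigenvalues_of_G2_Ricci (u v w : Fin 3 → ℝ)
    (huu : u ⬝ᵥ u = 1) (hvv : v ⬝ᵥ v = 1) (hww : w ⬝ᵥ w = 1)
    (huv : u ⬝ᵥ v = 0) (huw : u ⬝ᵥ w = 0) (hvw : v ⬝ᵥ w = 0)
    (φ ψ A : ℝ) (hA : 0 ≤ A) (R : Matrix (Fin 3) (Fin 3) ℝ)
    (hRdef : R = (φ - ψ) •
        (φ • Matrix.vecMulVec v v - ψ • Matrix.vecMulVec w w -
          A • (Matrix.vecMulVec v w + Matrix.vecMulVec w v)) -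
      ((1 / 2) * ((φ - ψ) ^ 2 + 4 * A ^ 2)) • (1 : Matrix (Fin 3) (Fin 3) ℝ))
    (hR : R.IsHermitian) :
    R *ᵥ u = (-(1 / 2) * ((φ - ψ) ^ 2 + 4 * A ^ 2)) • u ∧
      ∃ σ : Equiv.Perm (Fin 3),
        hR.eigenvalues ∘ σ =
          ![-(1 / 2) * ((φ - ψ) ^ 2 + 4 * A ^ 2),
            -2 * A ^ 2 + (1 / 2) * (φ - ψ) * Real.sqrt ((φ + ψ) ^ 2 + 4 * A ^ 2),
            -2 * A ^ 2 - (1 / 2) * (φ - ψ) * Real.sqrt ((φ + ψ) ^ 2 + 4 * A ^ 2)] := by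
  subst hRdef
  refine ⟨?_, hR.exists_perm_eigenvalues_comp_eq ?_⟩
  · have hvu : v ⬝ᵥ u = 0 := by rw [dotProduct_comm, huv]
    have hwu : w ⬝ᵥ u = 0 := by rw [dotProduct_comm, huw]
    simp [Matrix.sub_mulVec, Matrix.add_mulVec, Matrix.smul_mulVec, Matrix.vecMulVec_mulVec,
      hvu, hwu]
  · have hQP : Matrix.of ![u, v, w] * (Matrix.of ![u, v, w])ᵀ = 1 := by
      ext i j
      change ![u, v, w] i ⬝ᵥ ![u, v, w] j = _
      fin_cases i <;> fin_cases j <;>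
        simp [huu, hvv, hww, huv, huw, hvw, dotProduct_comm v u, dotProduct_comm w u,
          dotProduct_comm w v]
    refine Eq.trans ?_ ((Matrix.charpoly_conj_of_mul_eq_one hQP _).trans
      (charpoly_ricci_block φ ψ A))
    rw [mul_sub, sub_mul,
      Matrix.mul_smul, Matrix.mul_smul, Matrix.smul_mul, Matrix.smul_mul, mul_one,
      mul_eq_one_comm.mp hQP]
    congr 3
    ext i j
    simp [Matrix.mul_apply, Matrix.vecMulVec_apply, Fin.sum_univ_three]
    ring
end

section
/- Let (u, v, w) be an orthonormal basis of ℝ³, let φ, ψ, A be real numbers with A ≥ 0, and let R = (φ − ψ)·[φ·v vᵀ − ψ·w wᵀ − A·(v wᵀ + w vᵀ)] − (1/2)·[(φ − ψ)² + 4A²]·I. Then R has a repeated eigenvalue if and only if at least one of the following three conditions holds: (i) φ = ψ; (ii) A = 0 and φ + ψ = 0; (iii) A² + φψ = 0. -/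
open Matrix

theorem Matrix.charpoly_transpose_mul_mul_of_mul_transpose_eq_one {n : Type*} [Fintype n]
    [DecidableEq n] {P : Matrix n n ℝ} (hP : P * Pᵀ = 1) (D : Matrix n n ℝ) :
    (Pᵀ * D * P).charpoly = D.charpoly := by
  rw [Matrix.charpoly_mul_comm, ← Matrix.mul_assoc, hP, Matrix.one_mul]

theorem Matrix.IsHermitian.injective_eigenvalues_iff_nodup_roots_charpoly {n : Type*} [Fintype n]
    [DecidableEq n] {M : Matrix n n ℝ} (hM : M.IsHermitian) :
    Function.Injective hM.eigenvalues ↔ M.charpoly.roots.Nodup := by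
  rw [hM.roots_charpoly_eq_eigenvalues]
  change _ ↔ (Multiset.map hM.eigenvalues Finset.univ.val).Nodup
  rw [Finset.nodup_map_iff_injOn, Finset.coe_univ, Set.injOn_univ]

open Polynomial in
/-- The roots of the characteristic polynomial of a block matrix consisting of a scalar and a
symmetric `2 × 2` block. -/
theorem roots_charpoly_scalar_block (c a b e : ℝ) :
    (!![c, 0, 0; 0, a, e; 0, e, b] : Matrix (Fin 3) (Fin 3) ℝ).charpoly.roots =
      {c, (a + b + √((a - b) ^ 2 + 4 * e ^ 2)) / 2, (a + b - √((a - b) ^ 2 + 4 * e ^ 2)) / 2} := by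
  have hs : √((a - b) ^ 2 + 4 * e ^ 2) ^ 2 = (a - b) ^ 2 + 4 * e ^ 2 :=
    Real.sq_sqrt (by positivity)
  generalize √((a - b) ^ 2 + 4 * e ^ 2) = s at hs ⊢
  rw [← roots_multiset_prod_X_sub_C {c, (a + b + s) / 2, (a + b - s) / 2}]
  congr 1
  refine Polynomial.funext fun t => ?_
  rw [Matrix.eval_charpoly, Matrix.det_fin_three]
  simp [Matrix.scalar_apply]
  linear_combination (t - c) / 4 * hs

/-- For an orthonormal basis `(u,v,w)` of ℝ³, `A ≥ 0`, and
`R = (φ − ψ)·[φ·v vᵀ − ψ·w wᵀ − A·(v wᵀ + w vᵀ)] − (1/2)·[(φ − ψ)² + 4A²]·I`,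
`R` has a repeated eigenvalue iff `φ = ψ`, or (`A = 0` and `φ + ψ = 0`), or `A² + φψ = 0`. -/
theorem repeated_eigenvalue_iff_G2 (u v w : Fin 3 → ℝ)
    (huu : u ⬝ᵥ u = 1) (hvv : v ⬝ᵥ v = 1) (hww : w ⬝ᵥ w = 1)
    (huv : u ⬝ᵥ v = 0) (huw : u ⬝ᵥ w = 0) (hvw : v ⬝ᵥ w = 0)
    (φ ψ A : ℝ) (hA : 0 ≤ A) (R : Matrix (Fin 3) (Fin 3) ℝ)
    (hRdef : R = (φ - ψ) •
        (φ • Matrix.vecMulVec v v - ψ • Matrix.vecMulVec w w -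
          A • (Matrix.vecMulVec v w + Matrix.vecMulVec w v)) -
      ((1 / 2) * ((φ - ψ) ^ 2 + 4 * A ^ 2)) • (1 : Matrix (Fin 3) (Fin 3) ℝ))
    (hR : R.IsHermitian) :
    ¬ Function.Injective hR.eigenvalues ↔
      φ = ψ ∨ (A = 0 ∧ φ + ψ = 0) ∨ A ^ 2 + φ * ψ = 0 := by
  set d := φ - ψ with hd
  set c := (1 / 2) * (d ^ 2 + 4 * A ^ 2) with hc
  have hP : Matrix.of ![u, v, w] * (Matrix.of ![u, v, w])ᵀ = 1 := by
    have key : ∀ i j, (Matrix.of ![u, v, w] * (Matrix.of ![u, v, w])ᵀ) i j =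
        ![u, v, w] i ⬝ᵥ ![u, v, w] j := fun _ _ => rfl
    ext i j
    rw [key]
    fin_cases i <;> fin_cases j <;>
      simp [huu, hvv, hww, huv, huw, hvw, dotProduct_comm v u, dotProduct_comm w u,
        dotProduct_comm w v]
  have hR' : R = (Matrix.of ![u, v, w])ᵀ *
      !![-c, 0, 0; 0, d * φ - c, -(d * A); 0, -(d * A), -(d * ψ) - c] *
      Matrix.of ![u, v, w] := by
    rw [hRdef, ← mul_eq_one_comm.mp hP]
    ext i j
    simp [Matrix.mul_apply, Fin.sum_univ_three, Matrix.vecMulVec_apply]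
    ring
  have hsqrt : √((d * φ - c - (-(d * ψ) - c)) ^ 2 + 4 * (-(d * A)) ^ 2) =
      |d| * √((φ + ψ) ^ 2 + 4 * A ^ 2) := by
    rw [← Real.sqrt_sq_eq_abs, ← Real.sqrt_mul (sq_nonneg d)]
    congr 1
    ring
  rw [hR.injective_eigenvalues_iff_nodup_roots_charpoly, hR',
    Matrix.charpoly_transpose_mul_mul_of_mul_transpose_eq_one hP, roots_charpoly_scalar_block,
    hsqrt]
  have hs : √((φ + ψ) ^ 2 + 4 * A ^ 2) ^ 2 = (φ + ψ) ^ 2 + 4 * A ^ 2 :=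
    Real.sq_sqrt (by positivity)
  generalize √((φ + ψ) ^ 2 + 4 * A ^ 2) = s at hs ⊢
  have hd2 : |d| ^ 2 = d ^ 2 := sq_abs d
  have hdz : |d| = 0 ↔ d = 0 := abs_eq_zero
  generalize |d| = m at hd2 hdz ⊢
  simp only [Multiset.insert_eq_cons, Multiset.nodup_cons, Multiset.mem_cons,
    Multiset.mem_singleton, Multiset.nodup_singleton, and_true, not_and_or, not_or, not_not]
  have hprod : (d * d + m * s) * (d * d - m * s) = -4 * d ^ 2 * (A ^ 2 + φ * ψ) := by
    rw [hd] at hd2 ⊢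
    linear_combination -s ^ 2 * hd2 - (φ - ψ) ^ 2 * hs
  constructor
  · rintro ((h | h) | h)
    · have h0 : d * d + m * s = 0 := by rw [hd] at h ⊢; linarith
      rw [h0, zero_mul] at hprod
      by_cases hz : d = 0
      · exact Or.inl (sub_eq_zero.mp hz)
      · exact Or.inr (Or.inr (by simpa [hz] using hprod.symm))
    · have h0 : d * d - m * s = 0 := by rw [hd] at h ⊢; linarith
      rw [h0, mul_zero] at hprod
      by_cases hz : d = 0
      · exact Or.inl (sub_eq_zero.mp hz)
      · exact Or.inr (Or.inr (by simpa [hz] using hprod.symm))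
    · have h0 : m * s = 0 := by linarith
      rcases mul_eq_zero.mp h0 with h1 | h1
      · exact Or.inl (sub_eq_zero.mp (hdz.mp h1))
      · rw [h1] at hs
        exact Or.inr (Or.inl ⟨by nlinarith, by nlinarith⟩)
  · rintro (h | ⟨h1, h2⟩ | h)
    · have hm : m = 0 := hdz.mpr (sub_eq_zero.mpr h)
      right
      rw [hm]
      ring
    · have hz : s = 0 := by
        rw [h1, h2] at hs
        simpa using hs
      right
      rw [hz]
      ring
    · rw [h, mul_zero] at hprod
      left
      rcases mul_eq_zero.mp hprod with h0 | h0
      · left; rw [hd] at h0 ⊢; linarith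
      · right; rw [hd] at h0 ⊢; linarith
end

section
/- Let N be a real symmetric 3×3 matrix with orthonormal eigenvectors u₁, u₂, u₃ and corresponding eigenvalues φ₁, φ₂, φ₃ satisfying φ₂ + φ₃ = φ₁, and set R = 2N² − (tr N)·N + ((tr N)²/2 − tr N²)·I. Then R = 2φ₂φ₃ · u₁ u₁ᵀ; in particular R has eigenvalue 2φ₂φ₃ along u₁ and eigenvalue 0 on the plane spanned by u₂ and u₃. -/
open Matrix

/-- A matrix with an orthonormal eigenbasis is diagonalized by the matrix of eigenvectors. -/
theorem Matrix.eq_transpose_mul_diagonal_mul_of_orthonormal {n K : Type*} [Fintype n]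
    [DecidableEq n] [CommRing K] {A : Matrix n n K} {u : n → n → K} {c : n → K}
    (horth : ∀ i j, u i ⬝ᵥ u j = if i = j then 1 else 0)
    (heig : ∀ i, A *ᵥ u i = c i • u i) :
    A = (of u)ᵀ * diagonal c * of u := by
  have h₁ : of u * (of u)ᵀ = 1 := by
    ext i j
    simpa [mul_apply, dotProduct, one_apply] using horth i j
  have h₂ : (of u)ᵀ * of u = 1 := mul_eq_one_comm.mp h₁
  have h₃ : A * (of u)ᵀ = (of u)ᵀ * diagonal c := by
    ext i j
    rw [mul_diagonal]
    simpa [mul_apply, mulVec, dotProduct, mul_comm (c j)]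
      using congrFun (heig j) i
  rw [← h₃, Matrix.mul_assoc, h₂, Matrix.mul_one]

theorem Matrix.trace_eq_sum_of_orthonormal {n K : Type*} [Fintype n]
    [DecidableEq n] [CommRing K] {A : Matrix n n K} {u : n → n → K} {c : n → K}
    (horth : ∀ i j, u i ⬝ᵥ u j = if i = j then 1 else 0)
    (heig : ∀ i, A *ᵥ u i = c i • u i) :
    A.trace = ∑ i, c i := by
  have h₁ : of u * (of u)ᵀ = 1 := by
    ext i j
    simpa [mul_apply, dotProduct, one_apply] using horth i j
  rw [eq_transpose_mul_diagonal_mul_of_orthonormal horth heig, trace_mul_comm,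
    ← Matrix.mul_assoc, h₁, Matrix.one_mul, trace_diagonal]

/-- For a real symmetric 3×3 matrix `N` with orthonormal eigenvectors `u₁,u₂,u₃` and
eigenvalues `φ₁,φ₂,φ₃` with `φ₂ + φ₃ = φ₁`, the matrix
`R = 2N² − (tr N)·N + ((tr N)²/2 − tr N²)·I` equals `2φ₂φ₃·u₁u₁ᵀ`; in particular `R` has
eigenvalue `2φ₂φ₃` along `u₁` and eigenvalue `0` on the plane spanned by `u₂, u₃`. -/
theorem Ricci_rank_one_case (N : Matrix (Fin 3) (Fin 3) ℝ) (hN : Nᵀ = N)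
    (u : Fin 3 → Fin 3 → ℝ) (φ : Fin 3 → ℝ)
    (horth : ∀ i j : Fin 3, u i ⬝ᵥ u j = if i = j then 1 else 0)
    (heig : ∀ i : Fin 3, N *ᵥ u i = φ i • u i)
    (hφ : φ 1 + φ 2 = φ 0)
    (R : Matrix (Fin 3) (Fin 3) ℝ)
    (hR : R = (2 : ℝ) • N ^ 2 - N.trace • N +
      (N.trace ^ 2 / 2 - (N ^ 2).trace) • (1 : Matrix (Fin 3) (Fin 3) ℝ)) :
    R = (2 * φ 1 * φ 2) • Matrix.vecMulVec (u 0) (u 0) ∧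
      R *ᵥ u 0 = (2 * φ 1 * φ 2) • u 0 ∧
      R *ᵥ u 1 = 0 ∧ R *ᵥ u 2 = 0 := by
  have hsq : ∀ i, (N ^ 2) *ᵥ u i = (φ i ^ 2) • u i := fun i => by
    rw [sq, ← mulVec_mulVec, heig, mulVec_smul, heig, smul_smul, sq]
  have hR_eig : ∀ i, R *ᵥ u i = (![2 * φ 1 * φ 2, 0, 0] : Fin 3 → ℝ) i • u i := fun i => by
    rw [hR, trace_eq_sum_of_orthonormal horth heig, trace_eq_sum_of_orthonormal horth hsq,
      add_mulVec, sub_mulVec, smul_mulVec, smul_mulVec, smul_mulVec, one_mulVec, hsq, heig,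
      smul_smul, smul_smul, ← sub_smul, ← add_smul]
    congr 1
    fin_cases i <;> simp [Fin.sum_univ_three, ← hφ] <;> ring
  have hP_eig : ∀ i, ((2 * φ 1 * φ 2) • vecMulVec (u 0) (u 0)) *ᵥ u i =
      (![2 * φ 1 * φ 2, 0, 0] : Fin 3 → ℝ) i • u i := fun i => by
    rw [smul_mulVec, vecMulVec_mulVec, horth]
    fin_cases i <;> simp
  refine ⟨?_, by simpa using hR_eig 0, by simpa using hR_eig 1, by simpa using hR_eig 2⟩
  rw [eq_transpose_mul_diagonal_mul_of_orthonormal horth hR_eig,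
    eq_transpose_mul_diagonal_mul_of_orthonormal horth hP_eig]
end

section
/- Let N be a positive definite real symmetric 3×3 matrix and set R = 2N² − (tr N)·N + ((tr N)²/2 − tr N²)·I. Then R is a scalar multiple of the identity matrix if and only if N is a scalar multiple of the identity matrix. -/
open Matrix

/-- A Hermitian matrix all of whose eigenvalues agree is scalar. -/
theorem Matrix.IsHermitian.eq_smul_one_of_eigenvalues_eq {n : Type*} [Fintype n] [DecidableEq n]
    {A : Matrix n n ℝ} (hA : A.IsHermitian) {c : ℝ} (h : ∀ i, hA.eigenvalues i = c) :
    A = c • (1 : Matrix n n ℝ) := by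
  have hD : diagonal (RCLike.ofReal ∘ hA.eigenvalues : n → ℝ) = c • (1 : Matrix n n ℝ) := by
    rw [smul_one_eq_diagonal]
    congr 1
    funext i
    simp [h i]
  rw [hA.spectral_theorem, hD, map_smul, map_one]

/-- If a quadratic polynomial in a Hermitian matrix is scalar, then its eigenvalues satisfy
the corresponding quadratic equation. -/
theorem Matrix.IsHermitian.eigenvalues_quadratic {n : Type*} [Fintype n] [DecidableEq n]
    {A : Matrix n n ℝ} (hA : A.IsHermitian) {p q s : ℝ}
    (h : p • A ^ 2 + q • A = s • (1 : Matrix n n ℝ)) (i : n) :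
    p * hA.eigenvalues i ^ 2 + q * hA.eigenvalues i = s := by
  have hv := hA.mulVec_eigenvectorBasis i
  have hne : (hA.eigenvectorBasis i).ofLp ≠ 0 := fun h0 =>
    hA.eigenvectorBasis.orthonormal.ne_zero i (by ext j; exact congrFun h0 j)
  have key := congrArg (· *ᵥ (hA.eigenvectorBasis i).ofLp) h
  simp only [add_mulVec, smul_mulVec, pow_two, ← mulVec_mulVec, hv, mulVec_smul, one_mulVec,
    smul_smul, ← add_smul] at key
  have := smul_left_injective ℝ hne key
  linarith

/-- For a positive definite real symmetric 3×3 matrix `N` and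
`R = 2N² − (tr N)·N + ((tr N)²/2 − tr N²)·I`, the matrix `R` is a scalar multiple of the
identity if and only if `N` is a scalar multiple of the identity. -/
theorem Ricci_proportional_iff_N_proportional (N : Matrix (Fin 3) (Fin 3) ℝ)
    (hsymm : Nᵀ = N)
    (hpos : ∀ x : Fin 3 → ℝ, x ≠ 0 → 0 < x ⬝ᵥ (N *ᵥ x))
    (R : Matrix (Fin 3) (Fin 3) ℝ)
    (hR : R = (2 : ℝ) • N ^ 2 - N.trace • N +
      (N.trace ^ 2 / 2 - (N ^ 2).trace) • (1 : Matrix (Fin 3) (Fin 3) ℝ)) :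
    (∃ c : ℝ, R = c • (1 : Matrix (Fin 3) (Fin 3) ℝ)) ↔
      (∃ c : ℝ, N = c • (1 : Matrix (Fin 3) (Fin 3) ℝ)) := by
  have hN : N.IsHermitian := by simpa [IsHermitian] using hsymm
  constructor
  · rintro ⟨c, hc⟩
    have hquad := hN.eigenvalues_quadratic (p := 2) (q := -N.trace)
      (s := c - (N.trace ^ 2 / 2 - (N ^ 2).trace)) (by
        rw [sub_smul, ← hc, hR, neg_smul]; abel)
    have hpd : N.PosDef := PosDef.of_dotProduct_mulVec_pos hN (by simpa using hpos)
    have htr : N.trace = hN.eigenvalues 0 + hN.eigenvalues 1 + hN.eigenvalues 2 := by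
      simp [hN.trace_eq_sum_eigenvalues, Fin.sum_univ_three]
    have h0 := hquad 0
    have h1 := hquad 1
    have h2 := hquad 2
    have p0 : 0 < hN.eigenvalues 0 := hpd.eigenvalues_pos 0
    have p1 : 0 < hN.eigenvalues 1 := hpd.eigenvalues_pos 1
    have p2 : 0 < hN.eigenvalues 2 := hpd.eigenvalues_pos 2
    generalize c - (N.trace ^ 2 / 2 - (N ^ 2).trace) = s at h0 h1 h2
    rw [htr] at h0 h1 h2
    have e01 : (hN.eigenvalues 0 - hN.eigenvalues 1) *
        (hN.eigenvalues 0 + hN.eigenvalues 1 - hN.eigenvalues 2) = 0 := by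
      linear_combination h0 - h1
    have e12 : (hN.eigenvalues 1 - hN.eigenvalues 2) *
        (hN.eigenvalues 1 + hN.eigenvalues 2 - hN.eigenvalues 0) = 0 := by
      linear_combination h1 - h2
    have e02 : (hN.eigenvalues 0 - hN.eigenvalues 2) *
        (hN.eigenvalues 0 + hN.eigenvalues 2 - hN.eigenvalues 1) = 0 := by
      linear_combination h0 - h2
    have heq : hN.eigenvalues 1 = hN.eigenvalues 0 ∧ hN.eigenvalues 2 = hN.eigenvalues 0 := by
      rcases mul_eq_zero.mp e01 with h | h <;> rcases mul_eq_zero.mp e12 with h' | h' <;>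
        rcases mul_eq_zero.mp e02 with h'' | h'' <;> constructor <;> linarith
    refine ⟨hN.eigenvalues 0, hN.eq_smul_one_of_eigenvalues_eq fun i => ?_⟩
    fin_cases i
    exacts [rfl, heq.1, heq.2]
  · rintro ⟨c, hc⟩
    refine ⟨2 * c ^ 2 - N.trace * c + (N.trace ^ 2 / 2 - (N ^ 2).trace), ?_⟩
    have hsq : N ^ 2 = c ^ 2 • (1 : Matrix (Fin 3) (Fin 3) ℝ) := by rw [hc, smul_pow, one_pow]
    generalize N.trace ^ 2 / 2 - (N ^ 2).trace = s at hR ⊢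
    generalize N.trace = t at hR ⊢
    rw [hR, hsq, hc, smul_smul, smul_smul, ← sub_smul, ← add_smul]
end

section
/- Let x, y ∈ ℝ³ be linearly independent vectors and let q be a real number with q² < 4. Then the symmetric matrix M = (q/2)(x yᵀ + y xᵀ) − x xᵀ − y yᵀ has rank 2 and is negative semidefinite: its eigenvalues are 0 together with two negative eigenvalues whose sum is q⟨x, y⟩ − ‖x‖² − ‖y‖² < 0 and whose product is ((4 − q²)/4)(‖x‖²‖y‖² − ⟨x, y⟩²) > 0. -/
open Matrix

/-- The strict Cauchy–Schwarz inequality for the dot product. -/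
theorem LinearIndependent.dotProduct_sq_lt {n : Type*} [Fintype n] {x y : n → ℝ}
    (h : LinearIndependent ℝ ![x, y]) : (x ⬝ᵥ y) ^ 2 < (x ⬝ᵥ x) * (y ⬝ᵥ y) := by
  have pos : ∀ v : n → ℝ, v ≠ 0 → 0 < v ⬝ᵥ v := fun v hv => by
    simpa using Matrix.dotProduct_star_self_pos_iff.2 hv
  have hy : 0 < y ⬝ᵥ y := pos y (by simpa using h.ne_zero 1)
  have hz : (y ⬝ᵥ y) • x + (-(x ⬝ᵥ y)) • y ≠ 0 := fun hz =>
    hy.ne' (LinearIndependent.pair_iff.1 h _ _ hz).1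
  have hpos := pos _ hz
  simp only [add_dotProduct, dotProduct_add, smul_dotProduct, dotProduct_smul, smul_eq_mul,
    dotProduct_comm y x] at hpos
  have : 0 < (y ⬝ᵥ y) * ((x ⬝ᵥ x) * (y ⬝ᵥ y) - (x ⬝ᵥ y) ^ 2) := by linarith
  exact sub_pos.1 (pos_of_mul_pos_right this hy.le)

theorem Matrix.IsHermitian.det_scalar_sub_eq_prod {n : Type*} [Fintype n] [DecidableEq n]
    {M : Matrix n n ℝ} (hM : M.IsHermitian) (t : ℝ) :
    (Matrix.scalar n t - M).det = ∏ i, (t - hM.eigenvalues i) := by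
  rw [← Matrix.eval_charpoly, hM.charpoly_eq, Polynomial.eval_prod]
  simp

/-- A real triple with zero product, negative sum and positive second elementary symmetric
function consists of a zero and two negative numbers. -/
theorem exists_zero_and_two_neg {e : Fin 3 → ℝ} {s p : ℝ} (hs : s < 0) (hp : 0 < p)
    (h1 : e 0 + e 1 + e 2 = s) (h2 : e 0 * e 1 + e 1 * e 2 + e 2 * e 0 = p)
    (h3 : e 0 * e 1 * e 2 = 0) :
    ∃ i j k : Fin 3, i ≠ j ∧ i ≠ k ∧ j ≠ k ∧ e k = 0 ∧ e i < 0 ∧ e j < 0 ∧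
      e i + e j = s ∧ e i * e j = p := by
  have key : ∀ a b : ℝ, a + b = s → a * b = p → a < 0 ∧ b < 0 := by
    intro a b hab hmul
    rcases mul_pos_iff.1 (hmul ▸ hp) with h | h
    · linarith
    · exact h
  have aux : ∀ i j k : Fin 3, i ≠ j → i ≠ k → j ≠ k → e k = 0 → e i + e j = s → e i * e j = p →
      ∃ i j k : Fin 3, i ≠ j ∧ i ≠ k ∧ j ≠ k ∧ e k = 0 ∧ e i < 0 ∧ e j < 0 ∧
        e i + e j = s ∧ e i * e j = p := fun i j k hij hik hjk hk ha hm =>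
    ⟨i, j, k, hij, hik, hjk, hk, (key _ _ ha hm).1, (key _ _ ha hm).2, ha, hm⟩
  rcases mul_eq_zero.1 h3 with h | h
  · rcases mul_eq_zero.1 h with h | h
    · exact aux 1 2 0 (by decide) (by decide) (by decide) h (by simpa [h] using h1)
        (by simpa [h] using h2)
    · exact aux 2 0 1 (by decide) (by decide) (by decide) h
        (by rw [h] at h1; linarith) (by simpa [h] using h2)
  · exact aux 0 1 2 (by decide) (by decide) (by decide) h (by simpa [h] using h1)
      (by simpa [h] using h2)

/-- For linearly independent `x, y ∈ ℝ³` and `q² < 4`, the symmetric matrix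
`M = (q/2)(x yᵀ + y xᵀ) − x xᵀ − y yᵀ` has rank 2 and is negative semidefinite: its
eigenvalues are `0` together with two negative eigenvalues whose sum is
`q⟨x,y⟩ − ‖x‖² − ‖y‖² < 0` and whose product is `((4 − q²)/4)(‖x‖²‖y‖² − ⟨x,y⟩²) > 0`. -/
theorem typeVII_N_negative_semidefinite (x y : Fin 3 → ℝ)
    (hxy : LinearIndependent ℝ ![x, y])
    (q : ℝ) (hq : q ^ 2 < 4)
    (M : Matrix (Fin 3) (Fin 3) ℝ)
    (hM : M = (q / 2 : ℝ) • (Matrix.vecMulVec x y + Matrix.vecMulVec y x) -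
      Matrix.vecMulVec x x - Matrix.vecMulVec y y)
    (hMh : M.IsHermitian) :
    M.rank = 2 ∧ (∀ v : Fin 3 → ℝ, v ⬝ᵥ (M *ᵥ v) ≤ 0) ∧
      ∃ i j k : Fin 3, i ≠ j ∧ i ≠ k ∧ j ≠ k ∧
        hMh.eigenvalues k = 0 ∧ hMh.eigenvalues i < 0 ∧ hMh.eigenvalues j < 0 ∧
        hMh.eigenvalues i + hMh.eigenvalues j =
          q * (x ⬝ᵥ y) - x ⬝ᵥ x - y ⬝ᵥ y ∧
        q * (x ⬝ᵥ y) - x ⬝ᵥ x - y ⬝ᵥ y < 0 ∧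
        hMh.eigenvalues i * hMh.eigenvalues j =
          (4 - q ^ 2) / 4 * ((x ⬝ᵥ x) * (y ⬝ᵥ y) - (x ⬝ᵥ y) ^ 2) ∧
        0 < (4 - q ^ 2) / 4 * ((x ⬝ᵥ x) * (y ⬝ᵥ y) - (x ⬝ᵥ y) ^ 2) := by
  have hG := hxy.dotProduct_sq_lt
  have hdet : 0 < (4 - q ^ 2) / 4 * ((x ⬝ᵥ x) * (y ⬝ᵥ y) - (x ⬝ᵥ y) ^ 2) :=
    mul_pos (by linarith) (sub_pos.2 hG)
  have htr : q * (x ⬝ᵥ y) - x ⬝ᵥ x - y ⬝ᵥ y < 0 := by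
    have hx : 0 ≤ x ⬝ᵥ x := by simpa using dotProduct_star_self_nonneg x
    have hy : 0 ≤ y ⬝ᵥ y := by simpa using dotProduct_star_self_nonneg y
    have : (q * (x ⬝ᵥ y)) ^ 2 < (x ⬝ᵥ x + y ⬝ᵥ y) ^ 2 := by
      nlinarith [mul_nonneg (sub_nonneg.2 hq.le) (sq_nonneg (x ⬝ᵥ y)),
        sq_nonneg (x ⬝ᵥ x - y ⬝ᵥ y)]
    linarith [lt_of_pow_lt_pow_left₀ 2 (add_nonneg hx hy) this]
  have hchar : ∀ t : ℝ, ∏ i, (t - hMh.eigenvalues i) =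
      t ^ 3 - (q * (x ⬝ᵥ y) - x ⬝ᵥ x - y ⬝ᵥ y) * t ^ 2 +
        (4 - q ^ 2) / 4 * ((x ⬝ᵥ x) * (y ⬝ᵥ y) - (x ⬝ᵥ y) ^ 2) * t := by
    intro t
    rw [← hMh.det_scalar_sub_eq_prod, hM, Matrix.det_fin_three]
    simp [vecMulVec_apply, dotProduct, Fin.sum_univ_three]
    ring
  simp only [Fin.prod_univ_three] at hchar
  have h0 := hchar 0
  have hp := hchar 1
  have hm := hchar (-1)
  obtain ⟨i, j, k, hij, hik, hjk, hk, hi, hj, hadd, hmul⟩ :=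
    exists_zero_and_two_neg (e := hMh.eigenvalues) htr hdet (by linarith) (by linarith)
      (by linarith)
  refine ⟨?_, fun v => ?_, i, j, k, hij, hik, hjk, hk, hi, hj, hadd, htr, hmul, hdet⟩
  · rw [hMh.rank_eq_card_non_zero_eigs, Fintype.card_subtype]
    have : Finset.univ.filter (fun l => hMh.eigenvalues l ≠ 0) = {i, j} := by
      ext l
      have hl : l = i ∨ l = j ∨ l = k := by omega
      rcases hl with rfl | rfl | rfl
      · simp [hi.ne]
      · simp [hj.ne]
      · simp [hk, hik.symm, hjk.symm]
    rw [this, Finset.card_pair hij]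
  · have hv : v ⬝ᵥ (M *ᵥ v) = q * (v ⬝ᵥ x) * (v ⬝ᵥ y) - (v ⬝ᵥ x) ^ 2 - (v ⬝ᵥ y) ^ 2 := by
      rw [hM]
      simp [mulVec, vecMulVec_apply, dotProduct, Fin.sum_univ_three]
      ring
    rw [hv]
    nlinarith [sq_nonneg (v ⬝ᵥ x - q / 2 * (v ⬝ᵥ y)),
      mul_nonneg (sub_nonneg.2 hq.le) (sq_nonneg (v ⬝ᵥ y))]
end

section
/- Let x, y ∈ ℝ³ be linearly independent vectors, let q be a real number with q² < 4, and let M = (q/2)(x yᵀ + y xᵀ) − x xᵀ − y yᵀ. Then M has a repeated eigenvalue (equivalently, its two nonzero eigenvalues coincide) if and only if ‖x‖² = ‖y‖² and 2⟨x, y⟩ = q‖x‖². -/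
open Matrix

/-- The strict Cauchy–Schwarz inequality for linearly independent vectors. -/
theorem dotProduct_sq_lt_of_linearIndependent {n : Type*} [Fintype n] {x y : n → ℝ}
    (hxy : LinearIndependent ℝ ![x, y]) : (x ⬝ᵥ y) ^ 2 < (x ⬝ᵥ x) * (y ⬝ᵥ y) := by
  rw [LinearIndependent.pair_iff] at hxy
  have hy : y ≠ 0 := fun h => by simpa [h] using hxy 0 1
  have hB : 0 < y ⬝ᵥ y := by simpa using dotProduct_self_star_pos_iff.2 hy
  have hz : (y ⬝ᵥ y) • x + (-(x ⬝ᵥ y)) • y ≠ 0 := fun h => hB.ne' (hxy _ _ h).1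
  have hpos := dotProduct_self_star_pos_iff.2 hz
  have key : ((y ⬝ᵥ y) • x + (-(x ⬝ᵥ y)) • y) ⬝ᵥ ((y ⬝ᵥ y) • x + (-(x ⬝ᵥ y)) • y) =
      (y ⬝ᵥ y) * ((x ⬝ᵥ x) * (y ⬝ᵥ y) - (x ⬝ᵥ y) ^ 2) := by
    simp only [dotProduct_add, add_dotProduct, smul_dotProduct, dotProduct_smul, smul_eq_mul,
      dotProduct_comm y x]
    ring
  rw [star_trivial, key] at hpos
  linarith [pos_of_mul_pos_right hpos hB.le]

/-- The characteristic polynomial of `(q/2)(x yᵀ + y xᵀ) − x xᵀ − y yᵀ`, evaluated at `t`. -/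
theorem det_scalar_sub_typeVII (x y : Fin 3 → ℝ) (q t : ℝ) :
    (scalar (Fin 3) t - ((q / 2 : ℝ) • (vecMulVec x y + vecMulVec y x) -
      vecMulVec x x - vecMulVec y y)).det =
      t * (t ^ 2 - (q * (x ⬝ᵥ y) - x ⬝ᵥ x - y ⬝ᵥ y) * t +
        (1 - q ^ 2 / 4) * ((x ⬝ᵥ x) * (y ⬝ᵥ y) - (x ⬝ᵥ y) ^ 2)) := by
  simp [det_fin_three, vecMulVec_apply, dotProduct, Fin.sum_univ_three]
  ring

/-- Three numbers with vanishing product and nonvanishing second elementary symmetric function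
`e` are not pairwise distinct if and only if the square of their sum is `4 * e`. -/
theorem not_injective_iff_sum_sq_eq {f : Fin 3 → ℝ} (h₀ : f 0 * f 1 * f 2 = 0)
    (he : f 0 * f 1 + f 0 * f 2 + f 1 * f 2 ≠ 0) :
    ¬ Function.Injective f ↔
      (f 0 + f 1 + f 2) ^ 2 = 4 * (f 0 * f 1 + f 0 * f 2 + f 1 * f 2) := by
  have hinj : Function.Injective f ↔ f 0 ≠ f 1 ∧ f 0 ≠ f 2 ∧ f 1 ≠ f 2 := by
    refine ⟨fun h => ⟨h.ne (by decide), h.ne (by decide), h.ne (by decide)⟩, ?_⟩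
    rintro ⟨h₁, h₂, h₃⟩ i j hij
    fin_cases i <;> fin_cases j <;> simp_all
  rw [hinj]
  generalize f 0 = a at *
  generalize f 1 = b at *
  generalize f 2 = c at *
  have sq_iff : ∀ u v : ℝ, (u + v) ^ 2 = 4 * (u * v) ↔ u = v := fun u v => by
    rw [← sub_eq_zero (a := u), ← sq_eq_zero_iff (a := u - v), ← sub_eq_zero]
    ring_nf
  rcases mul_eq_zero.1 h₀ with h | rfl
  · rcases mul_eq_zero.1 h with rfl | rfl
    · have := sq_iff b c
      grind
    · have := sq_iff a c
      grind
  · have := sq_iff a b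
    grind

/-- For linearly independent `x, y ∈ ℝ³` and `q² < 4`, the symmetric matrix
`M = (q/2)(x yᵀ + y xᵀ) − x xᵀ − y yᵀ` has a repeated eigenvalue if and only if
`‖x‖² = ‖y‖²` and `2⟨x,y⟩ = q‖x‖²`. -/
theorem typeVII_repeated_eigenvalue_iff (x y : Fin 3 → ℝ)
    (hxy : LinearIndependent ℝ ![x, y])
    (q : ℝ) (hq : q ^ 2 < 4)
    (M : Matrix (Fin 3) (Fin 3) ℝ)
    (hM : M = (q / 2 : ℝ) • (Matrix.vecMulVec x y + Matrix.vecMulVec y x) -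
      Matrix.vecMulVec x x - Matrix.vecMulVec y y)
    (hMh : M.IsHermitian) :
    ¬ Function.Injective hMh.eigenvalues ↔
      x ⬝ᵥ x = y ⬝ᵥ y ∧ 2 * (x ⬝ᵥ y) = q * (x ⬝ᵥ x) := by
  have hCS := dotProduct_sq_lt_of_linearIndependent hxy
  have hchar : ∀ t : ℝ, (t - hMh.eigenvalues 0) * (t - hMh.eigenvalues 1) *
      (t - hMh.eigenvalues 2) = t * (t ^ 2 - (q * (x ⬝ᵥ y) - x ⬝ᵥ x - y ⬝ᵥ y) * t +
        (1 - q ^ 2 / 4) * ((x ⬝ᵥ x) * (y ⬝ᵥ y) - (x ⬝ᵥ y) ^ 2)) := fun t => by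
    rw [← det_scalar_sub_typeVII, ← hM, ← eval_charpoly, hMh.charpoly_eq]
    simp [Fin.prod_univ_three]
  generalize hMh.eigenvalues = f at *
  generalize x ⬝ᵥ x = A at *
  generalize y ⬝ᵥ y = B at *
  generalize x ⬝ᵥ y = C at *
  have h0 := hchar 0
  have h1 := hchar 1
  have h2 := hchar (-1)
  have hprod : f 0 * f 1 * f 2 = 0 := by linarith
  have hsum : f 0 + f 1 + f 2 = q * C - A - B := by linarith
  have hsymm : f 0 * f 1 + f 0 * f 2 + f 1 * f 2 = (1 - q ^ 2 / 4) * (A * B - C ^ 2) := by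
    linarith
  have hpos : 0 < (1 - q ^ 2 / 4) * (A * B - C ^ 2) := mul_pos (by linarith) (by linarith)
  rw [not_injective_iff_sum_sq_eq hprod (hsymm ▸ hpos.ne'), hsum, hsymm]
  constructor
  · intro h
    have hdisc : (2 * C - q * (A + B) / 2) ^ 2 + (1 - q ^ 2 / 4) * (A - B) ^ 2 = 0 := by
      linear_combination h
    have hq' : 0 < 1 - q ^ 2 / 4 := by linarith
    have hAB : (A - B) ^ 2 = 0 := by
      nlinarith [sq_nonneg (2 * C - q * (A + B) / 2), sq_nonneg (A - B)]
    rw [hAB, mul_zero, add_zero, sq_eq_zero_iff] at hdisc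
    rw [sq_eq_zero_iff] at hAB
    exact ⟨by linarith, by linear_combination hdisc - q / 2 * hAB⟩
  · rintro ⟨rfl, h⟩
    linear_combination (2 * C - q * A) * h
end
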